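/- arXiv:2312.04002 — 2 statements merged into one kernel-verified Lean document; each statement's English description precedes it below -/
import Mathlib

section
/- Let α ∈ ℝ\ℤ and B₀ > 0, and let k ∈ ℤ and m ≥ 0 be an integer. Then the function V_{k,m}(x) = |x|^{|k+α|} e^{−B₀|x|²/4} P_{k,m}(B₀|x|²/2) ((x₁+ix₂)/|x|)^k satisfies, at every point x ∈ ℝ²\{0}, the eigenvalue equation −ΔV_{k,m}(x) + (B₀²|x|²/4 + α²/|x|² + αB₀) V_{k,m}(x) − i(B₀ + 2α/|x|²) (x^⊥ · ∇V_{k,m})(x) = λ_{k,m} V_{k,m}(x), where λ_{k,m} = (2m + 1 + |k+α| + k + α)B₀ and x^⊥ = (−x₂, x₁). -/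
noncomputable section

/-- Euclidean norm of a point of `ℝ²`. -/
def nrm (x : ℝ × ℝ) : ℝ := Real.sqrt (x.1 ^ 2 + x.2 ^ 2)

/-- The Pochhammer symbol `(a)_n = a(a+1)⋯(a+n−1)`. -/
def poch (a : ℝ) (n : ℕ) : ℝ := (ascPochhammer ℝ n).eval a

/-- The polynomial `P_{k,m}(r) = Σ_{n=0}^m [(−m)_n / (1+|k+α|)_n] r^n/n!`. -/
def Pkm (α : ℝ) (k : ℤ) (m : ℕ) (r : ℝ) : ℝ :=
  ∑ n ∈ Finset.range (m + 1),
    poch (-(m : ℝ)) n / poch (1 + |(k : ℝ) + α|) n * r ^ n / n.factorial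

/-- The eigenfunction `V_{k,m}(x) = |x|^{|k+α|} e^{−B₀|x|²/4} P_{k,m}(B₀|x|²/2)
((x₁+ix₂)/|x|)^k`. -/
def Vkm (α B₀ : ℝ) (k : ℤ) (m : ℕ) (x : ℝ × ℝ) : ℂ :=
  ((nrm x ^ |(k : ℝ) + α| : ℝ) : ℂ) *
    Complex.exp (-((B₀ : ℂ) * (nrm x : ℂ) ^ 2) / 4) *
    ((Pkm α k m (B₀ * nrm x ^ 2 / 2) : ℝ) : ℂ) *
    (((x.1 : ℂ) + x.2 * Complex.I) / (nrm x : ℂ)) ^ k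

/-- First partial derivative of a function on `ℝ²`. -/
def pd1 (f : ℝ × ℝ → ℂ) (x : ℝ × ℝ) : ℂ := fderiv ℝ f x (1, 0)

/-- Second partial derivative of a function on `ℝ²`. -/
def pd2 (f : ℝ × ℝ → ℂ) (x : ℝ × ℝ) : ℂ := fderiv ℝ f x (0, 1)

/-- The Laplacian of a function on `ℝ²`. -/
def lap (f : ℝ × ℝ → ℂ) (x : ℝ × ℝ) : ℂ := pd1 (pd1 f) x + pd2 (pd2 f) x

/-- The model function `x ↦ g(|x|²) (x₁+ix₂)ⁿ`. -/
def radialMul (g : ℝ → ℝ) (n : ℤ) (x : ℝ × ℝ) : ℂ :=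
  (g (x.1 ^ 2 + x.2 ^ 2) : ℂ) * ((x.1 : ℂ) + x.2 * Complex.I) ^ n

lemma sq_add_sq_pos_of_ne_zero {x : ℝ × ℝ} (hx : x ≠ 0) : 0 < x.1 ^ 2 + x.2 ^ 2 := by
  rcases not_and_or.1 (mt Prod.ext_iff.2 hx) with h | h
  · have := sq_pos_of_ne_zero h
    simp only [Prod.fst_zero] at *
    positivity
  · have := sq_pos_of_ne_zero h
    simp only [Prod.snd_zero] at *
    positivity

lemma fst_add_snd_mul_I_ne_zero {x : ℝ × ℝ} (hx : x ≠ 0) :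
    (x.1 : ℂ) + x.2 * Complex.I ≠ 0 := by
  intro h
  apply hx
  have h1 := congrArg Complex.re h
  have h2 := congrArg Complex.im h
  simp at h1 h2
  exact Prod.ext h1 h2

lemma hasFDerivAt_ofReal_fst (x : ℝ × ℝ) :
    HasFDerivAt (fun y : ℝ × ℝ => (y.1 : ℂ))
      (Complex.ofRealCLM.comp (ContinuousLinearMap.fst ℝ ℝ ℝ)) x :=
  (Complex.ofRealCLM.comp (ContinuousLinearMap.fst ℝ ℝ ℝ)).hasFDerivAt

lemma hasFDerivAt_ofReal_snd (x : ℝ × ℝ) :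
    HasFDerivAt (fun y : ℝ × ℝ => (y.2 : ℂ))
      (Complex.ofRealCLM.comp (ContinuousLinearMap.snd ℝ ℝ ℝ)) x :=
  (Complex.ofRealCLM.comp (ContinuousLinearMap.snd ℝ ℝ ℝ)).hasFDerivAt

lemma exists_hasFDerivAt_radialMul {g : ℝ → ℝ} {g' : ℝ} (n : ℤ) {x : ℝ × ℝ} (hx : x ≠ 0)
    (hg : HasDerivAt g g' (x.1 ^ 2 + x.2 ^ 2)) :
    ∃ L : ℝ × ℝ →L[ℝ] ℂ, HasFDerivAt (radialMul g n) L x ∧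
      L (1, 0) = 2 * x.1 * g' * ((x.1 : ℂ) + x.2 * Complex.I) ^ n +
        n * (g (x.1 ^ 2 + x.2 ^ 2) * ((x.1 : ℂ) + x.2 * Complex.I) ^ (n - 1)) ∧
      L (0, 1) = 2 * x.2 * g' * ((x.1 : ℂ) + x.2 * Complex.I) ^ n +
        Complex.I * n * (g (x.1 ^ 2 + x.2 ^ 2) * ((x.1 : ℂ) + x.2 * Complex.I) ^ (n - 1)) := by
  have hs := ((hasFDerivAt_fst (𝕜 := ℝ) (p := x)).pow 2).add
    ((hasFDerivAt_snd (𝕜 := ℝ) (p := x)).pow 2)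
  have hG := Complex.ofRealCLM.hasFDerivAt.comp x (hg.comp_hasFDerivAt x hs)
  have hz := (hasFDerivAt_ofReal_fst x).add
    ((hasFDerivAt_ofReal_snd x).mul_const Complex.I)
  have hZ := (hasDerivAt_zpow n _ (Or.inl (fst_add_snd_mul_I_ne_zero hx))).comp_hasFDerivAt x hz
  refine ⟨_, hG.mul hZ, ?_, ?_⟩
  · simp
    ring
  · simp
    ring

lemma differentiableAt_radialMul {g : ℝ → ℝ} {g' : ℝ} (n : ℤ) {x : ℝ × ℝ} (hx : x ≠ 0)
    (hg : HasDerivAt g g' (x.1 ^ 2 + x.2 ^ 2)) : DifferentiableAt ℝ (radialMul g n) x :=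
  (exists_hasFDerivAt_radialMul n hx hg).choose_spec.1.differentiableAt

lemma pd1_radialMul {g : ℝ → ℝ} {g' : ℝ} (n : ℤ) {x : ℝ × ℝ} (hx : x ≠ 0)
    (hg : HasDerivAt g g' (x.1 ^ 2 + x.2 ^ 2)) :
    pd1 (radialMul g n) x = 2 * x.1 * g' * ((x.1 : ℂ) + x.2 * Complex.I) ^ n +
      n * radialMul g (n - 1) x := by
  obtain ⟨L, hL, h1, -⟩ := exists_hasFDerivAt_radialMul n hx hg
  rw [pd1, hL.fderiv, h1, radialMul]

lemma pd2_radialMul {g : ℝ → ℝ} {g' : ℝ} (n : ℤ) {x : ℝ × ℝ} (hx : x ≠ 0)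
    (hg : HasDerivAt g g' (x.1 ^ 2 + x.2 ^ 2)) :
    pd2 (radialMul g n) x = 2 * x.2 * g' * ((x.1 : ℂ) + x.2 * Complex.I) ^ n +
      Complex.I * n * radialMul g (n - 1) x := by
  obtain ⟨L, hL, -, h2⟩ := exists_hasFDerivAt_radialMul n hx hg
  rw [pd2, hL.fderiv, h2, radialMul]

lemma lap_radialMul {g g' g'' : ℝ → ℝ} (n : ℤ) {x : ℝ × ℝ} (hx : x ≠ 0)
    (hg : ∀ s, 0 < s → HasDerivAt g (g' s) s) (hg' : ∀ s, 0 < s → HasDerivAt g' (g'' s) s) :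
    lap (radialMul g n) x =
      ((4 * (x.1 ^ 2 + x.2 ^ 2) * g'' (x.1 ^ 2 + x.2 ^ 2) +
        4 * (1 + n) * g' (x.1 ^ 2 + x.2 ^ 2) : ℝ) : ℂ) *
        ((x.1 : ℂ) + x.2 * Complex.I) ^ n := by
  have hs := sq_add_sq_pos_of_ne_zero hx
  have hz := fst_add_snd_mul_I_ne_zero hx
  have hnhds : ∀ᶠ y : ℝ × ℝ in nhds x, y ≠ 0 := isOpen_ne.mem_nhds hx
  have e1 : pd1 (radialMul g n) =ᶠ[nhds x]
      fun y => 2 * (y.1 * radialMul g' n y) + n * radialMul g (n - 1) y := by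
    filter_upwards [hnhds] with y hy
    rw [pd1_radialMul n hy (hg _ (sq_add_sq_pos_of_ne_zero hy)), radialMul, radialMul]
    ring
  have e2 : pd2 (radialMul g n) =ᶠ[nhds x]
      fun y => 2 * (y.2 * radialMul g' n y) + Complex.I * n * radialMul g (n - 1) y := by
    filter_upwards [hnhds] with y hy
    rw [pd2_radialMul n hy (hg _ (sq_add_sq_pos_of_ne_zero hy)), radialMul, radialMul]
    ring
  have d1 := (differentiableAt_radialMul n hx (hg' _ hs)).hasFDerivAt
  have d0 := (differentiableAt_radialMul (n - 1) hx (hg _ hs)).hasFDerivAt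
  have p1 : pd1 (pd1 (radialMul g n)) x =
      2 * (x.1 * pd1 (radialMul g' n) x + radialMul g' n x) +
        n * pd1 (radialMul g (n - 1)) x := by
    rw [pd1, (e1.hasFDerivAt_iff.2
      ((((hasFDerivAt_ofReal_fst x).mul d1).const_mul 2).add (d0.const_mul _))).fderiv]
    simp [pd1, mul_add]
  have p2 : pd2 (pd2 (radialMul g n)) x =
      2 * (x.2 * pd2 (radialMul g' n) x + radialMul g' n x) +
        Complex.I * n * pd2 (radialMul g (n - 1)) x := by
    rw [pd2, (e2.hasFDerivAt_iff.2
      ((((hasFDerivAt_ofReal_snd x).mul d1).const_mul 2).add (d0.const_mul _))).fderiv]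
    simp [pd2, mul_add]
  rw [lap, p1, p2, pd1_radialMul n hx (hg' _ hs), pd2_radialMul n hx (hg' _ hs),
    pd1_radialMul (n - 1) hx (hg _ hs), pd2_radialMul (n - 1) hx (hg _ hs)]
  have hpow : ((x.1 : ℂ) + x.2 * Complex.I) ^ n =
      ((x.1 : ℂ) + x.2 * Complex.I) ^ (n - 1) * ((x.1 : ℂ) + x.2 * Complex.I) := by
    rw [← zpow_add_one₀ hz, sub_add_cancel]
  simp only [radialMul, hpow]
  push_cast
  linear_combination
    ((n : ℂ) * (n - 1) * (g (x.1 ^ 2 + x.2 ^ 2)) *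
      ((x.1 : ℂ) + x.2 * Complex.I) ^ (n - 1 - 1)) * Complex.I_sq

/-- The coefficients of the Kummer polynomial `₁F₁(−m; b; r)`. -/
def kummerCoeff (b : ℝ) (m n : ℕ) : ℝ :=
  poch (-(m : ℝ)) n / poch b n / n.factorial

/-- The Kummer polynomial `₁F₁(−m; b; r)`. -/
def kummerPoly (b : ℝ) (m : ℕ) : Polynomial ℝ :=
  ∑ n ∈ Finset.range (m + 1), Polynomial.monomial n (kummerCoeff b m n)

lemma poch_succ (a : ℝ) (n : ℕ) : poch a (n + 1) = poch a n * (a + n) := by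
  simp [poch, ascPochhammer_succ_right]

lemma poch_pos {a : ℝ} (ha : 0 < a) (n : ℕ) : 0 < poch a n :=
  ascPochhammer_pos n a ha

lemma poch_neg_eq_zero {m n : ℕ} (h : m < n) : poch (-(m : ℝ)) n = 0 := by
  induction n, h using Nat.le_induction with
  | base => simp [poch_succ]
  | succ n _ ih => simp [poch_succ, ih]

lemma kummerCoeff_succ {b : ℝ} (hb : 0 < b) (m n : ℕ) :
    (n + 1) * (b + n) * kummerCoeff b m (n + 1) = (n - m) * kummerCoeff b m n := by
  have h1 := (poch_pos hb n).ne'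
  have h2 : b + n ≠ 0 := by positivity
  have h3 : (n.factorial : ℝ) ≠ 0 := by positivity
  have h4 : (n : ℝ) + 1 ≠ 0 := by positivity
  simp only [kummerCoeff, poch_succ, Nat.factorial_succ]
  push_cast
  field_simp
  ring

lemma coeff_kummerPoly (b : ℝ) (m n : ℕ) : (kummerPoly b m).coeff n = kummerCoeff b m n := by
  simp only [kummerPoly, Polynomial.finsetSum_coeff, Polynomial.coeff_monomial,
    Finset.sum_ite_eq', Finset.mem_range]
  split_ifs with h
  · rfl
  · rw [kummerCoeff, poch_neg_eq_zero (by omega)]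
    simp

open Polynomial in
lemma kummerPoly_ode {b : ℝ} (hb : 0 < b) (m : ℕ) :
    X * derivative (derivative (kummerPoly b m)) + C b * derivative (kummerPoly b m) -
      X * derivative (kummerPoly b m) + C (m : ℝ) * kummerPoly b m = 0 := by
  ext n
  have h := kummerCoeff_succ hb m n
  cases n with
  | zero =>
    simp [coeff_derivative, coeff_kummerPoly] at h ⊢
    linarith
  | succ n =>
    simp [coeff_derivative, coeff_kummerPoly] at h ⊢
    linarith

lemma Pkm_eq_eval (α : ℝ) (k : ℤ) (m : ℕ) (r : ℝ) :
    Pkm α k m r = (kummerPoly (1 + |(k : ℝ) + α|) m).eval r := by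
  simp only [Pkm, kummerPoly, kummerCoeff, Polynomial.eval_finsetSum, Polynomial.eval_monomial]
  exact Finset.sum_congr rfl fun n _ => by ring

/-- The radial profile `s^β e^{−Bs/4} q(Bs/2)`, as a function of `s = |x|²`. -/
def profile (B β : ℝ) (q : Polynomial ℝ) (s : ℝ) : ℝ :=
  s ^ β * Real.exp (-(B * s) / 4) * q.eval (B * s / 2)

lemma hasDerivAt_profile (B β : ℝ) (q : Polynomial ℝ) {s : ℝ} (hs : 0 < s) :
    HasDerivAt (profile B β q)
      (β * profile B (β - 1) q s - B / 4 * profile B β q s +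
        B / 2 * profile B β q.derivative s) s := by
  have h1 := Real.hasDerivAt_rpow_const (p := β) (Or.inl hs.ne')
  have h2 := (((hasDerivAt_id s).const_mul B).neg.div_const 4).exp
  have h3 := (q.hasDerivAt (B * s / 2)).comp s (((hasDerivAt_id s).const_mul B).div_const 2)
  refine ((h1.mul h2).mul h3).congr_deriv ?_
  simp only [profile, Function.comp, id, Pi.neg_apply, Pi.mul_apply]
  ring

lemma profile_ode {B β ν κ : ℝ} (hν : 0 ≤ ν) (hβ : β = (ν - κ) / 2) (m : ℕ) {s : ℝ}
    (hs : 0 < s) {q : Polynomial ℝ} (hq : q = kummerPoly (1 + ν) m) {g' g'' : ℝ → ℝ}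
    (hg' : g' = fun s => β * profile B (β - 1) q s - B / 4 * profile B β q s +
      B / 2 * profile B β q.derivative s)
    (hg'' : g'' = fun s =>
      β * ((β - 1) * profile B (β - 1 - 1) q s - B / 4 * profile B (β - 1) q s +
        B / 2 * profile B (β - 1) q.derivative s) -
      B / 4 * g' s +
      B / 2 * (β * profile B (β - 1) q.derivative s - B / 4 * profile B β q.derivative s +
        B / 2 * profile B β q.derivative.derivative s)) :
    4 * s * g'' s + 4 * (1 + κ) * g' s =
      (B ^ 2 * s / 4 + (ν ^ 2 - κ ^ 2) / s - (2 * m + 1 + ν) * B) * profile B β q s := by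
  have hode := congrArg (Polynomial.eval (B * s / 2)) (kummerPoly_ode (b := 1 + ν) (by linarith) m)
  rw [← hq] at hode
  simp only [Polynomial.eval_add, Polynomial.eval_sub, Polynomial.eval_mul, Polynomial.eval_X,
    Polynomial.eval_C, Polynomial.eval_zero] at hode
  have hβ1 : s ^ (β - 1) = s ^ β / s := Real.rpow_sub_one hs.ne' β
  have hβ2 : s ^ (β - 1 - 1) = s ^ β / s / s := by rw [Real.rpow_sub_one hs.ne', hβ1]
  obtain rfl : ν = 2 * β + κ := by linarith
  simp only [hg'', hg', profile, hβ1, hβ2]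
  generalize q.derivative.derivative.eval (B * s / 2) = q₂ at hode ⊢
  generalize q.derivative.eval (B * s / 2) = q₁ at hode ⊢
  generalize q.eval (B * s / 2) = q₀ at hode ⊢
  field_simp
  linear_combination (32 * B * s) * hode

lemma Vkm_eq_radialMul (α B : ℝ) (k : ℤ) (m : ℕ) {x : ℝ × ℝ} (hx : x ≠ 0) :
    Vkm α B k m x =
      radialMul (profile B ((|(k : ℝ) + α| - k) / 2) (kummerPoly (1 + |(k : ℝ) + α|) m)) k x := by
  have hs := sq_add_sq_pos_of_ne_zero hx
  have hsq : nrm x ^ 2 = x.1 ^ 2 + x.2 ^ 2 := Real.sq_sqrt hs.le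
  have hn : 0 < nrm x := Real.sqrt_pos.2 hs
  have hpow : (x.1 ^ 2 + x.2 ^ 2) ^ ((|(k : ℝ) + α| - k) / 2) =
      nrm x ^ |(k : ℝ) + α| / nrm x ^ k := by
    rw [← hsq, ← Real.rpow_natCast, ← Real.rpow_mul hn.le, ← Real.rpow_intCast,
      ← Real.rpow_sub hn]
    congr 1
    push_cast
    ring
  have hexp : Complex.exp (-((B : ℂ) * (nrm x : ℂ) ^ 2) / 4) =
      (Real.exp (-(B * (x.1 ^ 2 + x.2 ^ 2)) / 4) : ℂ) := by
    rw [← hsq]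
    push_cast
    rfl
  rw [Vkm, radialMul, profile, hpow, hexp, Pkm_eq_eval, hsq, div_zpow]
  push_cast
  ring

/-- `V_{k,m}` satisfies, on `ℝ²\{0}`, the eigenvalue equation
`−ΔV + (B₀²|x|²/4 + α²/|x|² + αB₀)V − i(B₀ + 2α/|x|²)(x^⊥·∇V) = λ_{k,m} V` with
`λ_{k,m} = (2m+1+|k+α|+k+α)B₀`. -/
theorem Vkm_eigenfunction (α B₀ : ℝ) (hα : ∀ j : ℤ, α ≠ (j : ℝ)) (hB₀ : 0 < B₀)
    (k : ℤ) (m : ℕ) :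
    ∀ x : ℝ × ℝ, x ≠ 0 →
      -(lap (Vkm α B₀ k m) x) +
        (((B₀ ^ 2 * (x.1 ^ 2 + x.2 ^ 2) / 4 + α ^ 2 / (x.1 ^ 2 + x.2 ^ 2) + α * B₀ : ℝ)) : ℂ) *
          Vkm α B₀ k m x -
        Complex.I * (((B₀ + 2 * α / (x.1 ^ 2 + x.2 ^ 2) : ℝ)) : ℂ) *
          ((-(x.2 : ℂ)) * pd1 (Vkm α B₀ k m) x + (x.1 : ℂ) * pd2 (Vkm α B₀ k m) x) =
      (((2 * m + 1 + |(k : ℝ) + α| + k + α) * B₀ : ℝ) : ℂ) * Vkm α B₀ k m x := by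
  intro x hx
  have hs := sq_add_sq_pos_of_ne_zero hx
  have hz := fst_add_snd_mul_I_ne_zero hx
  set ν := |(k : ℝ) + α|
  have hνsq : ν ^ 2 = (k + α) ^ 2 := sq_abs _
  set q := kummerPoly (1 + ν) m with hq
  set β := (ν - k) / 2 with hβ
  have hV : ∀ y : ℝ × ℝ, y ≠ 0 → Vkm α B₀ k m y = radialMul (profile B₀ β q) k y :=
    fun y hy => Vkm_eq_radialMul α B₀ k m hy
  have hnhds : ∀ᶠ y : ℝ × ℝ in nhds x, y ≠ 0 := isOpen_ne.mem_nhds hx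
  have hev : Vkm α B₀ k m =ᶠ[nhds x] radialMul (profile B₀ β q) k := hnhds.mono hV
  have hp1 : pd1 (Vkm α B₀ k m) =ᶠ[nhds x] pd1 (radialMul (profile B₀ β q) k) :=
    (hev.fderiv (𝕜 := ℝ)).mono fun y hy => by simp only [pd1, hy]
  have hp2 : pd2 (Vkm α B₀ k m) =ᶠ[nhds x] pd2 (radialMul (profile B₀ β q) k) :=
    (hev.fderiv (𝕜 := ℝ)).mono fun y hy => by simp only [pd2, hy]
  have hlap : lap (Vkm α B₀ k m) x = lap (radialMul (profile B₀ β q) k) x := by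
    rw [lap, lap, pd1, hp1.fderiv_eq, pd2, hp2.fderiv_eq, pd1, pd2]
  have hg := fun s (h : 0 < s) => hasDerivAt_profile B₀ β q h
  have hg' := fun s (h : 0 < s) =>
    (((hasDerivAt_profile B₀ (β - 1) q h).const_mul β).sub
      ((hg s h).const_mul (B₀ / 4))).add
      ((hasDerivAt_profile B₀ β q.derivative h).const_mul (B₀ / 2))
  have hode := profile_ode (B := B₀) (abs_nonneg _) hβ m hs hq rfl rfl
  rw [hlap, hp1.self_of_nhds, hp2.self_of_nhds, hV x hx, lap_radialMul k hx hg hg', hode,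
    pd1_radialMul k hx (hg _ hs), pd2_radialMul k hx (hg _ hs), hνsq]
  have hpow : ((x.1 : ℂ) + x.2 * Complex.I) ^ k =
      ((x.1 : ℂ) + x.2 * Complex.I) ^ (k - 1) * ((x.1 : ℂ) + x.2 * Complex.I) := by
    rw [← zpow_add_one₀ hz, sub_add_cancel]
  have hrot : (-(x.2 : ℂ)) * ((k : ℂ) * radialMul (profile B₀ β q) (k - 1) x) +
      x.1 * (Complex.I * k * radialMul (profile B₀ β q) (k - 1) x) =
      Complex.I * k * radialMul (profile B₀ β q) k x := by
    simp only [radialMul, hpow]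
    linear_combination (-(x.2 : ℂ) * k * (profile B₀ β q (x.1 ^ 2 + x.2 ^ 2)) *
      ((x.1 : ℂ) + x.2 * Complex.I) ^ (k - 1)) * Complex.I_sq
  generalize radialMul (profile B₀ β q) (k - 1) x = R at hrot ⊢
  simp only [radialMul] at hrot ⊢
  generalize ((x.1 : ℂ) + x.2 * Complex.I) ^ k = Z at hrot ⊢
  generalize profile B₀ β q (x.1 ^ 2 + x.2 ^ 2) = G at hrot ⊢
  push_cast
  linear_combination
    (-Complex.I * (B₀ + 2 * α / ((x.1 : ℂ) ^ 2 + (x.2 : ℂ) ^ 2))) * hrot -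
    (B₀ + 2 * α / ((x.1 : ℂ) ^ 2 + (x.2 : ℂ) ^ 2)) * k * G * Z * Complex.I_sq
end
end

section
/- Let a, b, c, β > 0. Then the series Σ_{m=0}^∞ e^{−cm} (m!/Γ(m+β+1)) L_m^β(a) L_m^β(b) converges and equals (e^{βc/2} / ((ab)^{β/2}(1−e^{−c}))) · exp(−(a+b)e^{−c}/(1−e^{−c})) · I_β(2√(ab) e^{−c/2}/(1−e^{−c})). -/
noncomputable section

/-- The generalized Laguerre polynomial
`L_m^β(t) = Σ_{j=0}^m (−1)^j binom(m+β, m−j) t^j/j!`, with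
`binom(m+β, m−j) = Γ(m+β+1)/(Γ(j+β+1)(m−j)!)`. -/
def laguerre (m : ℕ) (β t : ℝ) : ℝ :=
  ∑ j ∈ Finset.range (m + 1),
    (-1) ^ j * (Real.Gamma (m + β + 1) / (Real.Gamma (j + β + 1) * (m - j).factorial)) *
      t ^ j / j.factorial

/-- The modified Bessel function `I_ν(z)` for real argument, defined by its power series. -/
def besselIR (ν z : ℝ) : ℝ :=
  ∑' n : ℕ, (z / 2) ^ ((2 * n + ν : ℝ)) / (n.factorial * Real.Gamma (n + ν + 1))

section

open Finset

/-- The negative binomial series. -/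
theorem hasSum_Gamma_add_div_factorial {s t : ℝ} (hs : 0 < s) (ht : |t| < 1) :
    HasSum (fun p : ℕ => Real.Gamma (s + p) / p.factorial * t ^ p)
      (Real.Gamma s / (1 - t) ^ s) := by
  have hG : ∀ p : ℕ, Real.Gamma (s + p) = (ascPochhammer ℝ p).eval s * Real.Gamma s := by
    intro p
    induction p with
    | zero => simp
    | succ p ih =>
      rw [ascPochhammer_succ_eval, Nat.cast_succ, ← add_assoc,
        Real.Gamma_add_one (by positivity), ih]
      ring
  have h := (Real.one_div_one_sub_rpow_hasFPowerSeriesOnBall_zero s).hasSum (y := t)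
    (by simpa [enorm_eq_nnnorm, ← NNReal.coe_lt_coe] using ht)
  rw [zero_add, one_div] at h
  rw [div_eq_mul_inv]
  convert! h.mul_left (Real.Gamma s) using 1
  funext p
  rw [hG, ← Polynomial.ascPochhammer_smeval_eq_eval,
    ← Ring.factorial_nsmul_multichoose_eq_ascPochhammer, Ring.multichoose_eq]
  have := p.factorial_ne_zero
  simp
  field_simp

/-- The Chu–Vandermonde identity in terms of the Gamma function. -/
theorem sum_choose_mul_descFactorial_mul_Gamma_div (n m : ℕ) {β : ℝ} (hβ : -1 < β) :
    ∑ i ∈ range (n + 1), (n.choose i : ℝ) *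
      (m.descFactorial i * (Real.Gamma (m + β + 1) / Real.Gamma (i + β + 1))) =
      Real.Gamma (m + n + β + 1) / Real.Gamma (n + β + 1) := by
  induction n generalizing m β with
  | zero => simp
  | succ n ih =>
    have hn : (0 : ℝ) < n + β + 1 := by have := n.cast_nonneg (α := ℝ); linarith
    rw [sum_choose_succ_mul (fun i _ => (m.descFactorial i : ℝ) *
      (Real.Gamma (m + β + 1) / Real.Gamma (i + β + 1))), ih m hβ]
    have hG := (Real.Gamma_pos_of_pos hn).ne'
    have h₁ : Real.Gamma ((n + 1 : ℕ) + β + 1) = (n + β + 1) * Real.Gamma (n + β + 1) := by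
      rw [← Real.Gamma_add_one hn.ne']; push_cast; ring_nf
    have h₂ : Real.Gamma (m + (n + 1 : ℕ) + β + 1) =
        (m + n + β + 1) * Real.Gamma (m + n + β + 1) := by
      rw [← Real.Gamma_add_one (by have := m.cast_nonneg (α := ℝ); linarith)]; push_cast; ring_nf
    have h₃ : ∑ i ∈ range (n + 1), (n.choose i : ℝ) * (m.descFactorial (i + 1) *
        (Real.Gamma (m + β + 1) / Real.Gamma ((i + 1 : ℕ) + β + 1))) =
        m * (Real.Gamma (m + n + β + 1) / Real.Gamma ((n + 1 : ℕ) + β + 1)) := by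
      cases m with
      | zero => simp
      | succ m =>
        have h := ih m (β := β + 1) (by linarith)
        rw [show (m + n + (β + 1) + 1 : ℝ) = (m + 1 : ℕ) + n + β + 1 by push_cast; ring,
          show (n + (β + 1) + 1 : ℝ) = (n + 1 : ℕ) + β + 1 by push_cast; ring] at h
        rw [← h, mul_sum]
        refine sum_congr rfl fun i _ => ?_
        rw [Nat.succ_descFactorial_succ]
        push_cast
        ring_nf
    rw [h₃, h₁, h₂]
    field_simp
    ring

/-- The Laguerre polynomial with its terms extended by zero to a series. -/
theorem hasSum_laguerre (m : ℕ) (β x : ℝ) :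
    HasSum (fun j : ℕ => m.descFactorial j *
      (Real.Gamma (m + β + 1) / Real.Gamma (j + β + 1)) * (-x) ^ j / j.factorial)
      (m.factorial * laguerre m β x) := by
  have h := hasSum_sum_of_ne_finset_zero (L := SummationFilter.unconditional ℕ)
    (f := fun j : ℕ => m.descFactorial j *
      (Real.Gamma (m + β + 1) / Real.Gamma (j + β + 1)) * (-x) ^ j / j.factorial)
    (s := range (m + 1)) (by
      intro j hj
      simp [Nat.descFactorial_of_lt (show m < j by simpa using hj)])
  convert! h using 1
  rw [laguerre, mul_sum]
  refine sum_congr rfl fun j hj => ?_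
  have hj' : j ≤ m := by simpa [Nat.lt_succ_iff] using hj
  have := (m - j).factorial_ne_zero
  rw [← Nat.factorial_mul_descFactorial hj', neg_pow x]
  push_cast
  field_simp

/-- Kummer's transformation for Laguerre polynomials. -/
theorem hasSum_exp_neg_mul_laguerre (m : ℕ) {β : ℝ} (hβ : -1 < β) (x : ℝ) :
    HasSum (fun n : ℕ => (-x) ^ n / n.factorial *
      (Real.Gamma (m + n + β + 1) / Real.Gamma (n + β + 1)))
      (m.factorial * (Real.exp (-x) * laguerre m β x)) := by
  have hL := hasSum_laguerre m β x
  have hE : HasSum (fun n : ℕ => (-x) ^ n / n.factorial) (Real.exp (-x)) := by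
    rw [Real.exp_eq_exp_ℝ]
    exact NormedSpace.expSeries_div_hasSum_exp (-x)
  have hp := summable_norm_sum_mul_antidiagonal_of_summable_norm hL.summable.norm hE.summable.norm
  have ht := tsum_mul_tsum_eq_tsum_sum_antidiagonal_of_summable_norm
    hL.summable.norm hE.summable.norm
  rw [hL.tsum_eq, hE.tsum_eq] at ht
  convert! hp.of_norm.hasSum using 1
  · funext n
    rw [← sum_choose_mul_descFactorial_mul_Gamma_div n m hβ, mul_sum,
      Nat.sum_antidiagonal_eq_sum_range_succ_mk]
    refine sum_congr rfl fun i hi => ?_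
    have hi' : i ≤ n := by simpa [Nat.lt_succ_iff] using hi
    have h₁ := (n - i).factorial_ne_zero
    have h₂ := n.factorial_ne_zero
    have h₃ := i.factorial_ne_zero
    rw [Nat.cast_choose ℝ hi']
    nth_rw 1 [← Nat.add_sub_cancel' hi']
    rw [pow_add]
    field_simp
  · rw [← ht]
    ring

/-- Generating function of the Laguerre polynomials in terms of the Bessel series. -/
theorem hasSum_laguerre_div_Gamma {β : ℝ} (hβ : -1 < β) (x y : ℝ)
    {S : ℝ} (hS : HasSum (fun j : ℕ => (-x * y) ^ j / (j.factorial * Real.Gamma (j + β + 1))) S) :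
    HasSum (fun n : ℕ => y ^ n / Real.Gamma (n + β + 1) * laguerre n β x) (S * Real.exp y) := by
  have hE : HasSum (fun n : ℕ => y ^ n / n.factorial) (Real.exp y) := by
    rw [Real.exp_eq_exp_ℝ]
    exact NormedSpace.expSeries_div_hasSum_exp y
  have hp := summable_norm_sum_mul_antidiagonal_of_summable_norm hS.summable.norm hE.summable.norm
  have ht := tsum_mul_tsum_eq_tsum_sum_antidiagonal_of_summable_norm
    hS.summable.norm hE.summable.norm
  rw [hS.tsum_eq, hE.tsum_eq] at ht
  rw [ht]
  convert! hp.of_norm.hasSum using 1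
  funext n
  rw [laguerre, mul_sum, Nat.sum_antidiagonal_eq_sum_range_succ_mk]
  refine sum_congr rfl fun i hi => ?_
  have hi' : i ≤ n := by simpa [Nat.lt_succ_iff] using hi
  have hG : Real.Gamma (n + β + 1) ≠ 0 :=
    (Real.Gamma_pos_of_pos (by have := n.cast_nonneg (α := ℝ); linarith)).ne'
  nth_rw 1 [← Nat.add_sub_cancel' hi']
  rw [pow_add, neg_mul, neg_pow (x * y), mul_pow]
  field_simp

theorem HasSum.prod_of_nonneg {ι κ : Type*} {f : ι × κ → ℝ} {g : ι → ℝ} {s : ℝ} (hf : 0 ≤ f)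
    (hg : ∀ i, HasSum (fun k => f (i, k)) (g i)) (hs : HasSum g s) : HasSum f s := by
  have hsum : Summable f := (summable_prod_of_nonneg hf).2
    ⟨fun i => (hg i).summable, by simpa only [(hg _).tsum_eq] using hs.summable⟩
  rw [hs.unique (hsum.hasSum.prod_fiberwise hg)]
  exact hsum.hasSum

theorem summable_pow_div_factorial_mul_Gamma {β : ℝ} (hβ : 0 ≤ β) (z : ℝ) :
    Summable (fun j : ℕ => z ^ j / (j.factorial * Real.Gamma (j + β + 1))) := by
  have hG : ∀ j : ℕ, Real.Gamma (β + 1) ≤ Real.Gamma (j + β + 1) := by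
    intro j
    induction j with
    | zero => simp
    | succ j ih =>
      have hj : (0 : ℝ) < j + β + 1 := by positivity
      rw [show ((j + 1 : ℕ) + β + 1 : ℝ) = (j + β + 1) + 1 by push_cast; ring,
        Real.Gamma_add_one hj.ne']
      exact ih.trans (le_mul_of_one_le_left (Real.Gamma_pos_of_pos hj).le
        (by have := j.cast_nonneg (α := ℝ); linarith))
  have h₀ : 0 < Real.Gamma (β + 1) := Real.Gamma_pos_of_pos (by positivity)
  refine ((Real.summable_pow_div_factorial |z|).div_const (Real.Gamma (β + 1))).of_norm_bounded
    fun j => ?_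
  rw [norm_div, norm_mul, norm_pow, Real.norm_eq_abs, Real.norm_natCast, div_div,
    Real.norm_of_nonneg (h₀.le.trans (hG j))]
  gcongr
  exact hG j

/-- The terms of the triple series whose two groupings are the two sides of the
Hille–Hardy formula. -/
def hilleHardyTerm (β a b t : ℝ) (q : ℕ × ℕ × ℕ) : ℝ :=
  (-b) ^ q.1 / (q.1.factorial * Real.Gamma (q.1 + β + 1)) *
    ((-a) ^ q.2.1 * t ^ (q.2.1 + q.2.2) /
      (q.2.1.factorial * Real.Gamma (q.2.1 + β + 1) * q.2.2.factorial)) *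
    Real.Gamma (q.2.1 + q.2.2 + q.1 + β + 1)

theorem hasSum_hilleHardyTerm_fst_snd {β t : ℝ} (hβ : 0 ≤ β) (ht₀ : 0 ≤ t) (ht₁ : t < 1)
    (a b : ℝ) (i j : ℕ) :
    HasSum (fun p => hilleHardyTerm β a b t (i, j, p))
      ((-(b / (1 - t))) ^ i / (i.factorial * Real.Gamma (i + β + 1)) / (1 - t) ^ (β + 1) *
        ((-(a * t / (1 - t))) ^ j / j.factorial *
          (Real.Gamma (i + j + β + 1) / Real.Gamma (j + β + 1)))) := by
  have h1t : 0 < 1 - t := by linarith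
  have h := (hasSum_Gamma_add_div_factorial (s := i + j + β + 1) (t := t) (by positivity)
    (by rwa [abs_of_nonneg ht₀])).mul_left ((-b) ^ i / (i.factorial * Real.Gamma (i + β + 1)) *
      ((-a * t) ^ j / (j.factorial * Real.Gamma (j + β + 1))))
  convert! h using 1
  · funext p
    rw [hilleHardyTerm]
    dsimp only
    rw [show (j + p + i + β + 1 : ℝ) = i + j + β + 1 + p by ring, pow_add, mul_pow]
    field_simp
  · rw [show (i + j + β + 1 : ℝ) = (β + 1) + (i : ℝ) + j by ring, Real.rpow_add h1t (_ + _),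
      Real.rpow_add h1t (β + 1), Real.rpow_natCast, Real.rpow_natCast, ← neg_div, ← neg_div,
      div_pow, div_pow, neg_mul]
    field_simp

theorem hasSum_hilleHardyTerm_fst {β : ℝ} (hβ : 0 ≤ β) (a b t : ℝ) (i : ℕ) :
    HasSum (fun j : ℕ =>
      (-(b / (1 - t))) ^ i / (i.factorial * Real.Gamma (i + β + 1)) / (1 - t) ^ (β + 1) *
        ((-(a * t / (1 - t))) ^ j / j.factorial *
          (Real.Gamma (i + j + β + 1) / Real.Gamma (j + β + 1))))
      (Real.exp (-(a * t / (1 - t))) / (1 - t) ^ (β + 1) *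
        ((-(b / (1 - t))) ^ i / Real.Gamma (i + β + 1) * laguerre i β (a * t / (1 - t)))) := by
  convert! (hasSum_exp_neg_mul_laguerre i (by linarith : -1 < β) (a * t / (1 - t))).mul_left
    ((-(b / (1 - t))) ^ i / (i.factorial * Real.Gamma (i + β + 1)) / (1 - t) ^ (β + 1)) using 1
  have := i.factorial_ne_zero
  field_simp

theorem hasSum_exp_mul_laguerre_scaled {β t : ℝ} (hβ : 0 ≤ β) (ht₁ : t < 1) (a b : ℝ) :
    HasSum (fun i : ℕ => Real.exp (-(a * t / (1 - t))) / (1 - t) ^ (β + 1) *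
        ((-(b / (1 - t))) ^ i / Real.Gamma (i + β + 1) * laguerre i β (a * t / (1 - t))))
      (Real.exp (-(a * t / (1 - t))) / (1 - t) ^ (β + 1) *
        ((∑' j : ℕ, (a * b * t / (1 - t) ^ 2) ^ j / (j.factorial * Real.Gamma (j + β + 1))) *
          Real.exp (-(b / (1 - t))))) := by
  refine (hasSum_laguerre_div_Gamma (by linarith) _ _ ?_).mul_left _
  convert! (summable_pow_div_factorial_mul_Gamma hβ (a * b * t / (1 - t) ^ 2)).hasSum using 4
  have h1t : 1 - t ≠ 0 := by linarith
  field_simp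

theorem summable_hilleHardyTerm {β t : ℝ} (hβ : 0 ≤ β) (ht₀ : 0 ≤ t) (ht₁ : t < 1)
    (a b : ℝ) : Summable (hilleHardyTerm β a b t) := by
  have hG : ∀ n : ℝ, 0 ≤ n → 0 < Real.Gamma (n + β + 1) := fun n hn =>
    Real.Gamma_pos_of_pos (by positivity)
  have hnorm : ∀ q, ‖hilleHardyTerm β a b t q‖ = hilleHardyTerm β (-|a|) (-|b|) t q := by
    rintro ⟨i, j, p⟩
    simp only [hilleHardyTerm, norm_mul, norm_div, norm_pow, norm_neg, neg_neg, Nat.abs_cast,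
      Real.norm_eq_abs, abs_of_nonneg ht₀, abs_of_pos (hG i i.cast_nonneg),
      abs_of_pos (hG j j.cast_nonneg), abs_of_pos (hG (j + p + i) (by positivity))]
  have hnonneg : 0 ≤ hilleHardyTerm β (-|a|) (-|b|) t := fun q => hnorm q ▸ norm_nonneg _
  refine .of_norm ?_
  simp_rw [hnorm]
  exact (HasSum.prod_of_nonneg hnonneg (fun i => HasSum.prod_of_nonneg (fun q => hnonneg (i, q))
    (hasSum_hilleHardyTerm_fst_snd hβ ht₀ ht₁ _ _ i)
    (hasSum_hilleHardyTerm_fst hβ _ _ t i))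
    (hasSum_exp_mul_laguerre_scaled hβ ht₁ _ _)).summable

theorem hasSum_hilleHardyTerm {β t : ℝ} (hβ : 0 ≤ β) (ht₀ : 0 ≤ t) (ht₁ : t < 1)
    (a b : ℝ) :
    HasSum (hilleHardyTerm β a b t) (Real.exp (-(a * t / (1 - t))) / (1 - t) ^ (β + 1) *
        ((∑' j : ℕ, (a * b * t / (1 - t) ^ 2) ^ j / (j.factorial * Real.Gamma (j + β + 1))) *
          Real.exp (-(b / (1 - t))))) := by
  have hs := summable_hilleHardyTerm hβ ht₀ ht₁ a b
  have h₂ := hs.hasSum.prod_fiberwise fun i => (hs.prod_factor i).hasSum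
  have h₃ : ∀ i, ∑' q, hilleHardyTerm β a b t (i, q) = _ := fun i =>
    ((hs.prod_factor i).hasSum.prod_fiberwise
      (hasSum_hilleHardyTerm_fst_snd hβ ht₀ ht₁ a b i)).unique
      (hasSum_hilleHardyTerm_fst hβ a b t i)
  simp_rw [h₃] at h₂
  rw [← h₂.unique (hasSum_exp_mul_laguerre_scaled hβ ht₁ a b)]
  exact hs.hasSum

theorem hasSum_hilleHardyTerm_snd {β : ℝ} (hβ : 0 ≤ β) (a b t : ℝ) (j p : ℕ) :
    HasSum (fun i => hilleHardyTerm β a b t (i, j, p))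
      ((-a) ^ j * t ^ (j + p) / (j.factorial * Real.Gamma (j + β + 1) * p.factorial) *
        ((j + p).factorial * (Real.exp (-b) * laguerre (j + p) β b))) := by
  convert! (hasSum_exp_neg_mul_laguerre (j + p) (by linarith : -1 < β) b).mul_left
    ((-a) ^ j * t ^ (j + p) / (j.factorial * Real.Gamma (j + β + 1) * p.factorial)) using 1
  funext i
  rw [hilleHardyTerm]
  push_cast
  ring

/-- The Hille–Hardy formula, with the Bessel function written as a power series. -/
theorem hasSum_laguerre_mul_laguerre {β t : ℝ} (hβ : 0 ≤ β) (ht₀ : 0 ≤ t) (ht₁ : t < 1)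
    (a b : ℝ) :
    HasSum (fun m : ℕ => t ^ m * (m.factorial / Real.Gamma (m + β + 1)) *
        laguerre m β a * laguerre m β b)
      (Real.exp (-((a + b) * t) / (1 - t)) / (1 - t) ^ (β + 1) *
        ∑' j : ℕ, (a * b * t / (1 - t) ^ 2) ^ j / (j.factorial * Real.Gamma (j + β + 1))) := by
  have h := ((Equiv.prodComm _ _).hasSum_iff.2
    (hasSum_hilleHardyTerm hβ ht₀ ht₁ a b)).prod_fiberwise
    fun q => hasSum_hilleHardyTerm_snd hβ a b t q.1 q.2
  have h' := (HasAntidiagonal.sigmaAntidiagonalEquivProd.hasSum_iff.2 h).sigma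
    fun n => hasSum_fintype _
  convert! h'.mul_left (Real.exp b) using 1
  · funext m
    have hm := (Real.Gamma_pos_of_pos (by positivity : 0 < m + β + 1)).ne'
    have hE := Real.exp_ne_zero b
    simp only [Function.comp_apply, HasAntidiagonal.sigmaAntidiagonalEquivProd_apply]
    rw [sum_coe_sort (antidiagonal m) (fun q : ℕ × ℕ =>
      (-a) ^ q.1 * t ^ (q.1 + q.2) / (q.1.factorial * Real.Gamma (q.1 + β + 1) * q.2.factorial) *
        ((q.1 + q.2).factorial * (Real.exp (-b) * laguerre (q.1 + q.2) β b))),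
      laguerre, Nat.sum_antidiagonal_eq_sum_range_succ_mk, mul_sum, sum_mul, mul_sum]
    refine sum_congr rfl fun j hj => ?_
    have hj' : j ≤ m := by simpa [Nat.lt_succ_iff] using hj
    dsimp only
    rw [Nat.add_sub_cancel' hj', neg_pow a, Real.exp_neg]
    field_simp
  · have h1t : 1 - t ≠ 0 := by linarith
    rw [show -((a + b) * t) / (1 - t) = -(a * t / (1 - t)) + (-(b / (1 - t)) + b) by
      field_simp; ring, Real.exp_add, Real.exp_add]
    ring

theorem besselIR_two_mul_sqrt (β : ℝ) {w : ℝ} (hw : 0 < w) :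
    besselIR β (2 * Real.sqrt w) =
      w ^ (β / 2) * ∑' j : ℕ, w ^ j / (j.factorial * Real.Gamma (j + β + 1)) := by
  rw [besselIR, ← tsum_mul_left]
  refine tsum_congr fun j => ?_
  rw [mul_div_cancel_left₀ _ two_ne_zero, Real.sqrt_eq_rpow, ← Real.rpow_mul hw.le,
    show 1 / 2 * (2 * j + β) = β / 2 + j by ring, Real.rpow_add hw, Real.rpow_natCast,
    mul_div_assoc]

end

/-- Poisson kernel formula for the generalized Laguerre polynomials: for `a, b, c, β > 0`,
`Σ_{m=0}^∞ e^{−cm} (m!/Γ(m+β+1)) L_m^β(a) L_m^β(b)` converges and equals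
`(e^{βc/2}/((ab)^{β/2}(1−e^{−c}))) exp(−(a+b)e^{−c}/(1−e^{−c})) I_β(2√(ab)e^{−c/2}/(1−e^{−c}))`. -/
theorem laguerre_poisson_kernel (a b c β : ℝ) (ha : 0 < a) (hb : 0 < b) (hc : 0 < c)
    (hβ : 0 < β) :
    HasSum (fun m : ℕ =>
        Real.exp (-(c * m)) * (m.factorial / Real.Gamma (m + β + 1)) *
          laguerre m β a * laguerre m β b)
      (Real.exp (β * c / 2) / ((a * b) ^ (β / 2) * (1 - Real.exp (-c))) *
        Real.exp (-((a + b) * Real.exp (-c)) / (1 - Real.exp (-c))) *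
        besselIR β (2 * Real.sqrt (a * b) * Real.exp (-c / 2) / (1 - Real.exp (-c)))) := by
  have ht : Real.exp (-c) < 1 := by simpa using hc
  have h1t : 0 < 1 - Real.exp (-c) := by linarith
  have habt : 0 < a * b * Real.exp (-c) := by positivity
  have hz : 2 * Real.sqrt (a * b) * Real.exp (-c / 2) / (1 - Real.exp (-c)) =
      2 * Real.sqrt (a * b * Real.exp (-c) / (1 - Real.exp (-c)) ^ 2) := by
    rw [Real.sqrt_div habt.le, Real.sqrt_sq h1t.le, Real.sqrt_mul (by positivity : 0 ≤ a * b),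
      Real.exp_half]
    ring
  rw [hz, besselIR_two_mul_sqrt β (by positivity)]
  convert! hasSum_laguerre_mul_laguerre hβ.le (Real.exp_pos (-c)).le ht a b using 1
  · funext m
    rw [← Real.exp_nat_mul]
    ring_nf
  · have hpow : ((1 - Real.exp (-c)) ^ 2) ^ (β / 2) = (1 - Real.exp (-c)) ^ β := by
      rw [← Real.rpow_natCast, ← Real.rpow_mul h1t.le]
      ring_nf
    rw [Real.div_rpow habt.le (by positivity), hpow,
      Real.mul_rpow (by positivity) (Real.exp_pos _).le, ← Real.exp_mul, Real.rpow_add h1t,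
      Real.rpow_one, show -c * (β / 2) = -(β * c / 2) by ring, Real.exp_neg (β * c / 2)]
    field_simp
end
end
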